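/- arXiv:1809.10971 — 2 statements merged into one kernel-verified Lean document; each statement's English description precedes it below -/
import Mathlib

section
/- Let F ⊂ P be a finite involutively head autoreduced set of nonzero polynomials (w.r.t. Pommaret division) and let m be a monomial. If f, g ∈ F both satisfy lm(f) Pommaret-divides m and lm(g) Pommaret-divides m, then f = g. In particular, if H is a Pommaret basis of an ideal I and f ∈ I is nonzero, there is exactly one h ∈ H with lm(h) Pommaret-dividing lm(f). -/
open MvPolynomial Finsupp

/-- Monomials in `n` variables, identified with their exponent vectors. -/
abbrev Mon (n : ℕ) := Fin n →₀ ℕ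

/-- Total degree of a monomial. -/
def mdeg {n : ℕ} (u : Mon n) : ℕ := u.sum fun _ e => e

/-- The strict degree reverse lexicographic order with `xₙ ≺ ⋯ ≺ x₁`
(the variable `xᵢ` of the paper corresponds to the index `i - 1 : Fin n`). -/
def drl {n : ℕ} (u v : Mon n) : Prop :=
  mdeg u < mdeg v ∨
    (mdeg u = mdeg v ∧ ∃ i : Fin n, v i < u i ∧ ∀ j : Fin n, i < j → u j = v j)

/-- The reflexive closure of `drl` (`⪯` for degrevlex). -/
def drle {n : ℕ} (u v : Mon n) : Prop := drl u v ∨ u = v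

/-- `m` is the degrevlex-leading monomial of `f`. -/
def IsLM {K : Type*} [Field K] {n : ℕ} (f : MvPolynomial (Fin n) K) (m : Mon n) : Prop :=
  m ∈ f.support ∧ ∀ m' ∈ f.support, m' = m ∨ drl m' m

/-- The degrevlex-leading monomial of `f` (junk value `0` for `f = 0`). -/
noncomputable def lm {K : Type*} [Field K] {n : ℕ} (f : MvPolynomial (Fin n) K) : Mon n := by
  classical exact if h : ∃ m, IsLM f m then h.choose else 0

/-- `xᵢ` is Pommaret-multiplicative for the monomial `u`, i.e. no variable strictly
larger in index (hence strictly smaller in the order `xₙ ≺ ⋯ ≺ x₁`) occurs in `u`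
beyond `xᵢ`; for `u = 1` every variable is multiplicative. -/
def PMult {n : ℕ} (u : Mon n) (i : Fin n) : Prop := ∀ j : Fin n, i < j → u j = 0

/-- `u` Pommaret-divides `w`: `w = u · m` for a monomial `m` involving only
Pommaret-multiplicative variables of `u`. -/
def PDiv {n : ℕ} (u w : Mon n) : Prop :=
  ∃ m : Mon n, w = u + m ∧ ∀ i : Fin n, m i ≠ 0 → PMult u i

theorem pDiv_iff {n : ℕ} {u w : Mon n} :
    PDiv u w ↔ ∀ i, u i ≤ w i ∧ (u i < w i → PMult u i) := by
  constructor
  · rintro ⟨a, rfl, ha⟩ i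
    have hi := ha i
    simp only [Finsupp.add_apply]
    exact ⟨by omega, fun h => hi (by omega)⟩
  · intro h
    refine ⟨w - u, ?_, fun i hi => (h i).2 ?_⟩
    · ext i
      have := (h i).1
      simp only [Finsupp.add_apply, Finsupp.tsub_apply]
      omega
    · simp only [Finsupp.tsub_apply] at hi
      omega

theorem PDiv.refl {n : ℕ} (u : Mon n) : PDiv u u :=
  pDiv_iff.2 fun _ => ⟨le_rfl, fun h => absurd h (lt_irrefl _)⟩

theorem PDiv.of_lt_at_first_difference {n : ℕ} {u v w : Mon n} (hu : PDiv u w) (hv : PDiv v w)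
    {i : Fin n} (hlt : u i < v i) (hmin : ∀ j < i, u j = v j) : PDiv u v := by
  have hui : PMult u i := (pDiv_iff.1 hu i).2 (hlt.trans_le (pDiv_iff.1 hv i).1)
  refine pDiv_iff.2 fun k => ?_
  rcases lt_trichotomy k i with hk | rfl | hk
  · exact ⟨(hmin k hk).le, fun h => absurd (hmin k hk) h.ne⟩
  · exact ⟨hlt.le, fun _ => hui⟩
  · exact ⟨by simp [hui k hk], fun _ j hj => hui j (hk.trans hj)⟩

/-- Two Pommaret divisors of the same monomial are comparable for Pommaret division. -/
theorem PDiv.total {n : ℕ} {u v w : Mon n} (hu : PDiv u w) (hv : PDiv v w) :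
    PDiv u v ∨ PDiv v u := by
  by_cases huv : u = v
  · exact Or.inl (huv ▸ PDiv.refl u)
  · obtain ⟨i, hi, hmin⟩ := WellFounded.has_min (wellFounded_lt (α := Fin n))
      {i | u i ≠ v i} (Finsupp.ne_iff.1 huv)
    have heq : ∀ j < i, u j = v j := fun j hj => by
      by_contra h
      exact hmin j h hj
    rcases lt_or_gt_of_ne hi with h | h
    · exact Or.inl (hu.of_lt_at_first_difference hv h heq)
    · exact Or.inr (hv.of_lt_at_first_difference hu h fun j hj => (heq j hj).symm)

theorem eq_of_pDiv_lm {K : Type*} [Field K] {n : ℕ} {F : Finset (MvPolynomial (Fin n) K)}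
    (hauto : ∀ f ∈ F, ∀ h ∈ F, f ≠ h → ¬ PDiv (lm h) (lm f)) {m : Mon n}
    {f g : MvPolynomial (Fin n) K} (hf : f ∈ F) (hg : g ∈ F)
    (hfm : PDiv (lm f) m) (hgm : PDiv (lm g) m) : f = g := by
  by_contra hne
  rcases hfm.total hgm with h | h
  · exact hauto g hg f hf (Ne.symm hne) h
  · exact hauto f hf g hg hne h

/-- in an involutively head autoreduced set the involutive divisor of a
monomial is unique; in particular every nonzero element of an ideal with a Pommaret
basis `H` has exactly one involutive divisor in `H`. -/
theorem statement14 {K : Type*} [Field K] {n : ℕ}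
    (F : Finset (MvPolynomial (Fin n) K)) (hF0 : ∀ f ∈ F, f ≠ 0)
    (hauto : ∀ f ∈ F, ∀ h ∈ F, f ≠ h → ¬ PDiv (lm h) (lm f))
    (m : Mon n) :
    (∀ f ∈ F, ∀ g ∈ F, PDiv (lm f) m → PDiv (lm g) m → f = g) ∧
    (∀ (I : Ideal (MvPolynomial (Fin n) K)) (H : Finset (MvPolynomial (Fin n) K)),
      (∀ h ∈ H, h ≠ 0) → (↑H ⊆ (I : Set (MvPolynomial (Fin n) K))) →
      (∀ f ∈ H, ∀ h ∈ H, f ≠ h → ¬ PDiv (lm h) (lm f)) →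
      (∀ f ∈ I, f ≠ 0 → ∃ h ∈ H, PDiv (lm h) (lm f)) →
      ∀ f ∈ I, f ≠ 0 → ∃! h, h ∈ H ∧ PDiv (lm h) (lm f)) := by
  refine ⟨fun f hf g hg => eq_of_pDiv_lm hauto hf hg, ?_⟩
  intro I H _ _ hH hbasis f hf hf0
  obtain ⟨h, hh, hdiv⟩ := hbasis f hf hf0
  exact ⟨h, ⟨hh, hdiv⟩, fun g hg => eq_of_pDiv_lm hH hg.1 hh hg.2 hdiv⟩
end

section
/- Let H = {h₁,…,h_t} be a Pommaret basis of an ideal I ⊆ P w.r.t. ≺. Then every f ∈ I possesses a unique involutive standard representation f = Σ_{j=1}^{t} P_j h_j in which each nonzero coefficient P_j is a polynomial only in the Pommaret multiplicative variables of lm(h_j) and satisfies lm(P_j h_j) ⪯ lm(f). -/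
open MvPolynomial Finsupp

section DegRevLex

variable {n : ℕ}

theorem mdeg_eq_degree (u : Mon n) : mdeg u = u.degree := rfl

theorem mdeg_add (u v : Mon n) : mdeg (u + v) = mdeg u + mdeg v := by
  simp [mdeg_eq_degree]

theorem drl_irrefl (u : Mon n) : ¬ drl u u := by
  rintro (h | ⟨-, i, h, -⟩) <;> exact lt_irrefl _ h

theorem drl_trans {u v w : Mon n} (huv : drl u v) (hvw : drl v w) : drl u w := by
  rcases huv with huv | ⟨e₁, i, hi, hi'⟩
  · rcases hvw with hvw | ⟨e₂, -⟩
    · exact Or.inl (huv.trans hvw)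
    · exact Or.inl (e₂ ▸ huv)
  · rcases hvw with hvw | ⟨e₂, j, hj, hj'⟩
    · exact Or.inl (e₁ ▸ hvw)
    · refine Or.inr ⟨e₁.trans e₂, ?_⟩
      rcases lt_trichotomy i j with hij | rfl | hij
      · exact ⟨j, hi' j hij ▸ hj, fun k hk => (hi' k (hij.trans hk)).trans (hj' k hk)⟩
      · exact ⟨i, hj.trans hi, fun k hk => (hi' k hk).trans (hj' k hk)⟩
      · exact ⟨i, hj' i hij ▸ hi, fun k hk => (hi' k hk).trans (hj' k (hij.trans hk))⟩

theorem drl_trichotomy (u v : Mon n) : drl u v ∨ u = v ∨ drl v u := by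
  rcases lt_trichotomy (mdeg u) (mdeg v) with h | h | h
  · exact Or.inl (Or.inl h)
  · by_cases huv : u = v
    · exact Or.inr (Or.inl huv)
    obtain ⟨i, hi⟩ : ∃ i, u i ≠ v i := by
      by_contra! hc
      exact huv (Finsupp.ext hc)
    obtain ⟨k, hk, hmax⟩ := (Finset.univ.filter fun i => u i ≠ v i).exists_maximal
      ⟨i, by simpa using hi⟩
    have hk' : u k ≠ v k := by simpa using hk
    have heq : ∀ j, k < j → u j = v j := fun j hj => by
      by_contra hne
      exact absurd (hmax (by simpa using hne) hj.le) (not_le.2 hj)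
    rcases lt_or_gt_of_ne hk' with hlt | hlt
    · exact Or.inr (Or.inr (Or.inr ⟨h.symm, k, hlt, fun j hj => (heq j hj).symm⟩))
    · exact Or.inl (Or.inr ⟨h, k, hlt, heq⟩)
  · exact Or.inr (Or.inr (Or.inl h))

theorem drl_add_left {u v : Mon n} (w : Mon n) (h : drl u v) : drl (w + u) (w + v) := by
  rcases h with h | ⟨e, i, hi, hi'⟩
  · exact Or.inl (by simpa [mdeg_add] using h)
  · exact Or.inr ⟨by simp [mdeg_add, e], i, by simpa using hi, fun j hj => by simp [hi' j hj]⟩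

theorem drle_of_le {u v : Mon n} (h : u ≤ v) : drle u v := by
  obtain ⟨w, rfl⟩ := exists_add_of_le h
  by_cases hw : w = 0
  · exact Or.inr (by simp [hw])
  · have : 0 < mdeg w := Nat.pos_of_ne_zero fun h0 => hw ((degree_eq_zero_iff w).1 h0)
    exact Or.inl (Or.inl (by rw [mdeg_add]; lia))

/-- Monomials ordered by the degree reverse lexicographic order. -/
def DegRevLex (n : ℕ) := Mon n

noncomputable instance : AddCommMonoid (DegRevLex n) := inferInstanceAs (AddCommMonoid (Mon n))

noncomputable instance : LinearOrder (DegRevLex n) where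
  le := drle (n := n)
  lt := drl (n := n)
  le_refl u := Or.inr rfl
  le_trans u v w := by
    rintro (h | rfl) (h' | rfl)
    exacts [Or.inl (drl_trans h h'), Or.inl h, Or.inl h', Or.inr rfl]
  le_antisymm u v := by
    rintro (h | rfl) (h' | h')
    exacts [(drl_irrefl _ (drl_trans h h')).elim, h'.symm, rfl, rfl]
  lt_iff_le_not_ge u v := by
    refine ⟨fun h => ⟨Or.inl h, ?_⟩, ?_⟩
    · rintro (h' | rfl)
      exacts [drl_irrefl _ (drl_trans h h'), drl_irrefl _ h]
    · rintro ⟨h | rfl, h'⟩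
      exacts [h, (h' (Or.inr rfl)).elim]
  le_total u v := by
    rcases drl_trichotomy u v with h | h | h
    exacts [Or.inl (Or.inl h), Or.inl (Or.inr h), Or.inr (Or.inl h)]
  toDecidableLE := Classical.decRel _

instance : IsOrderedAddMonoid (DegRevLex n) where
  add_le_add_left u v h w := by
    rcases h with h | rfl
    · rw [add_comm u, add_comm v]
      exact Or.inl (drl_add_left (n := n) w h)
    · exact le_rfl

instance : WellQuasiOrderedLE (DegRevLex n) where
  wqo f := by
    obtain ⟨a, b, hab, h⟩ := wellQuasiOrdered_le (α := Mon n) f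
    exact ⟨a, b, hab, drle_of_le h⟩

/-- The degree reverse lexicographic order as a `MonomialOrder`. -/
noncomputable def degRevLex (n : ℕ) : MonomialOrder (Fin n) where
  syn := DegRevLex n
  toSyn := { toEquiv := Equiv.refl (Mon n), map_add' := fun _ _ => rfl }
  toSyn_monotone _ _ h := drle_of_le h

theorem degRevLex_le_iff {u v : Mon n} :
    (degRevLex n).toSyn u ≤ (degRevLex n).toSyn v ↔ drle u v := Iff.rfl

theorem lm_eq_degree {K : Type*} [Field K] (f : MvPolynomial (Fin n) K) :
    lm f = (degRevLex n).degree f := by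
  classical
  by_cases hf : f = 0
  · subst hf
    have : ¬ ∃ m, IsLM (0 : MvPolynomial (Fin n) K) m := by simp [IsLM]
    simp [lm, this]
  have hd : IsLM f ((degRevLex n).degree f) :=
    ⟨(degRevLex n).degree_mem_support hf, fun m' hm' =>
      (degRevLex_le_iff.1 ((degRevLex n).le_degree hm')).symm⟩
  have hex : ∃ m, IsLM f m := ⟨_, hd⟩
  have hspec := hex.choose_spec
  have hlm : lm f = hex.choose := by simp only [lm, dif_pos hex]
  rw [hlm]
  rcases hspec.2 _ hd.1 with h | h
  · exact h.symm
  · rcases hd.2 _ hspec.1 with h' | h'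
    · exact h'
    · exact (drl_irrefl _ (drl_trans h h')).elim

end DegRevLex

section Pommaret

variable {n : ℕ}

theorem le_or_le_of_pommaret {u u' a a' : Mon n} (ha : ∀ i, a i ≠ 0 → PMult u i)
    (ha' : ∀ i, a' i ≠ 0 → PMult u' i) (h : u + a = u' + a') : u ≤ u' ∨ u' ≤ u := by
  by_contra! hc
  obtain ⟨i, hi⟩ : ∃ i, u' i < u i := by simpa [Finsupp.le_def] using hc.1
  obtain ⟨j, hj⟩ : ∃ j, u j < u' j := by simpa [Finsupp.le_def] using hc.2
  have hs (k) : u k + a k = u' k + a' k := DFunLike.congr_fun h k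
  have h1 : PMult u' i := ha' i (by have := hs i; lia)
  have h2 : PMult u j := ha j (by have := hs j; lia)
  rcases lt_trichotomy i j with hij | rfl | hij
  · have := h1 j hij
    lia
  · lia
  · have := h2 i hij
    lia

theorem PDiv.of_le {u u' a a' : Mon n} (ha : ∀ i, a i ≠ 0 → PMult u i)
    (h : u + a = u' + a') (hle : u ≤ u') : PDiv u u' := by
  refine ⟨u' - u, (add_tsub_cancel_of_le hle).symm, fun i hi => ha i ?_⟩
  have := DFunLike.congr_fun h i
  simp only [Finsupp.coe_add, Finsupp.coe_tsub, Pi.add_apply, Pi.sub_apply] at this hi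
  lia

theorem pdiv_or_pdiv {u u' a a' : Mon n} (ha : ∀ i, a i ≠ 0 → PMult u i)
    (ha' : ∀ i, a' i ≠ 0 → PMult u' i) (h : u + a = u' + a') : PDiv u u' ∨ PDiv u' u :=
  (le_or_le_of_pommaret ha ha' h).imp (.of_le ha h) (.of_le ha' h.symm)

end Pommaret

namespace MonomialOrder

variable {σ ι K : Type*} [Field K] [Fintype ι] (m : MonomialOrder σ)

theorem degree_sub_lt_of_leadingCoeff_eq {f g : MvPolynomial σ K}
    (hd : m.degree g = m.degree f) (hc : m.leadingCoeff g = m.leadingCoeff f) (hne : f - g ≠ 0) :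
    m.toSyn (m.degree (f - g)) < m.toSyn (m.degree f) := by
  refine lt_of_le_of_ne (m.degree_sub_le.trans (by simp [hd])) fun h => ?_
  apply m.coeff_degree_ne_zero_iff.2 hne
  rw [m.toSyn.injective h, coeff_sub]
  simp only [leadingCoeff, hd] at hc
  rw [hc, sub_self]

/-- Representations with the monomials of the `j`-th coefficient restricted to `S j` exist as soon
as every leading monomial of `I` lies in some cone `m.degree (h j) + S j`. -/
theorem exists_standard_representation {h : ι → MvPolynomial σ K} (hne : ∀ i, h i ≠ 0)
    {I : Ideal (MvPolynomial σ K)} (hmem : ∀ i, h i ∈ I) (S : ι → Set (σ →₀ ℕ))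
    (hbasis : ∀ f ∈ I, f ≠ 0 → ∃ i, ∃ a ∈ S i, m.degree f = m.degree (h i) + a)
    {f : MvPolynomial σ K} (hf : f ∈ I) (hf0 : f ≠ 0) :
    ∃ q : ι → MvPolynomial σ K, f = ∑ j, q j * h j ∧
      ∀ j, (∀ a ∈ (q j).support, a ∈ S j) ∧
        m.toSyn (m.degree (q j * h j)) ≤ m.toSyn (m.degree f) := by
  classical
  induction hd : m.toSyn (m.degree f) using WellFoundedLT.induction generalizing f with
  | ind d ih =>
    subst hd
    obtain ⟨i, a, ha, hdeg⟩ := hbasis f hf hf0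
    set c := m.leadingCoeff f / m.leadingCoeff (h i) with hc
    have hlc : m.leadingCoeff (h i) ≠ 0 := m.leadingCoeff_ne_zero_iff.2 (hne i)
    have hc0 : c ≠ 0 := div_ne_zero (m.leadingCoeff_ne_zero_iff.2 hf0) hlc
    have hmon : monomial a c ≠ 0 := by simpa using hc0
    have hgd : m.degree (monomial a c * h i) = m.degree f := by
      rw [m.degree_mul hmon (hne i), m.degree_monomial, if_neg hc0, hdeg, add_comm]
    have hgc : m.leadingCoeff (monomial a c * h i) = m.leadingCoeff f := by
      rw [m.leadingCoeff_mul, m.leadingCoeff_monomial, hc, div_mul_cancel₀ _ hlc]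
    obtain ⟨q, hq, hq'⟩ : ∃ q : ι → MvPolynomial σ K, f - monomial a c * h i = ∑ j, q j * h j ∧
        ∀ j, (∀ b ∈ (q j).support, b ∈ S j) ∧
          m.toSyn (m.degree (q j * h j)) ≤ m.toSyn (m.degree f) := by
      by_cases hz : f - monomial a c * h i = 0
      · exact ⟨0, by simp [hz], fun j => ⟨by simp, by simp⟩⟩
      · have hlt := m.degree_sub_lt_of_leadingCoeff_eq hgd hgc hz
        obtain ⟨q, hq, hq'⟩ := ih _ hlt (I.sub_mem hf (I.mul_mem_left _ (hmem i))) hz rfl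
        exact ⟨q, hq, fun j => ⟨(hq' j).1, (hq' j).2.trans hlt.le⟩⟩
    refine ⟨q + Pi.single i (monomial a c), ?_, fun j => ?_⟩
    · simp [add_mul, Finset.sum_add_distrib, ← hq, Pi.single_apply, ite_mul]
    · by_cases hj : j = i
      · subst hj
        simp only [Pi.add_apply, Pi.single_eq_same]
        refine ⟨fun b hb => ?_, ?_⟩
        · rcases Finset.mem_union.1 (MvPolynomial.support_add hb) with hb | hb
          · exact (hq' j).1 b hb
          · rwa [Finset.mem_singleton.1 (support_monomial_subset hb)]
        · rw [add_mul]
          exact m.degree_add_le.trans (sup_le (hq' j).2 (by rw [hgd]))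
      · simpa [hj] using hq' j

/-- If the cones `m.degree (h j) + S j` are disjoint, then zero has only the trivial
representation. -/
theorem eq_zero_of_sum_mul_eq_zero {h : ι → MvPolynomial σ K} (hne : ∀ i, h i ≠ 0)
    (S : ι → Set (σ →₀ ℕ))
    (hdisj : ∀ i j, i ≠ j → ∀ a ∈ S i, ∀ b ∈ S j, m.degree (h i) + a ≠ m.degree (h j) + b)
    {q : ι → MvPolynomial σ K} (hq : ∀ j, ∀ a ∈ (q j).support, a ∈ S j)
    (hsum : ∑ j, q j * h j = 0) : q = 0 := by
  classical
  by_contra hq0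
  obtain ⟨i, hi⟩ := Function.ne_iff.1 hq0
  obtain ⟨k, hk, hmax⟩ := (Finset.univ.filter fun j => q j ≠ 0).exists_max_image
    (fun j => m.toSyn (m.degree (q j * h j))) ⟨i, by simpa using hi⟩
  have hqk : q k ≠ 0 := by simpa using hk
  have hcoeff := congrArg (coeff (m.degree (q k * h k))) hsum
  rw [coeff_sum, coeff_zero, Finset.sum_eq_single k] at hcoeff
  · exact m.coeff_degree_ne_zero_iff.2 (mul_ne_zero hqk (hne k)) hcoeff
  · intro j _ hjk
    by_cases hqj : q j = 0
    · simp [hqj]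
    refine m.coeff_eq_zero_of_lt (lt_of_le_of_ne (hmax j (by simpa using hqj)) fun heq => ?_)
    have heq := m.toSyn.injective heq
    rw [m.degree_mul hqj (hne j), m.degree_mul hqk (hne k), add_comm, add_comm (m.degree (q k))]
      at heq
    exact hdisj j k hjk _ (hq j _ (m.degree_mem_support hqj)) _ (hq k _ (m.degree_mem_support hqk))
      heq
  · simp

end MonomialOrder

/-- every element of an ideal with Pommaret basis `{h₁, …, hₜ}` has a
unique involutive standard representation `f = Σ Pⱼ hⱼ` with every nonzero `Pⱼ`
involving only Pommaret multiplicative variables of `lm(hⱼ)` and satisfying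
`lm(Pⱼ hⱼ) ⪯ lm(f)`. -/
theorem statement16 {K : Type*} [Field K] {n t : ℕ}
    (h : Fin t → MvPolynomial (Fin n) K) (hne : ∀ i, h i ≠ 0) (hinj : Function.Injective h)
    (I : Ideal (MvPolynomial (Fin n) K)) (hmem : ∀ i, h i ∈ I)
    (hauto : ∀ i j : Fin t, i ≠ j → ¬ PDiv (lm (h j)) (lm (h i)))
    (hbasis : ∀ f ∈ I, f ≠ 0 → ∃ i, PDiv (lm (h i)) (lm f)) :
    ∀ f ∈ I, ∃! q : Fin t → MvPolynomial (Fin n) K,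
      f = ∑ j, q j * h j ∧
      ∀ j, q j ≠ 0 →
        (∀ m ∈ (q j).support, ∀ l : Fin n, m l ≠ 0 → PMult (lm (h j)) l) ∧
        f ≠ 0 ∧ drle (lm (q j * h j)) (lm f) := by
  intro f hf
  simp only [lm_eq_degree] at hauto hbasis ⊢
  set S : Fin t → Set (Mon n) :=
    fun j => {a | ∀ l, a l ≠ 0 → PMult ((degRevLex n).degree (h j)) l}
  have hdisj : ∀ i j, i ≠ j → ∀ a ∈ S i, ∀ b ∈ S j,
      (degRevLex n).degree (h i) + a ≠ (degRevLex n).degree (h j) + b :=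
    fun i j hij a ha b hb heq =>
      (pdiv_or_pdiv ha hb heq).elim (hauto j i hij.symm) (hauto i j hij)
  refine existsUnique_of_exists_of_unique ?_ ?_
  · by_cases hf0 : f = 0
    · exact ⟨0, by simp [hf0]⟩
    obtain ⟨q, hq, hq'⟩ := (degRevLex n).exists_standard_representation hne hmem S
      (fun g hg hg0 => by
        obtain ⟨i, a, ha, hm⟩ := hbasis g hg hg0
        exact ⟨i, a, hm, ha⟩) hf hf0
    exact ⟨q, hq, fun j _ => ⟨(hq' j).1, hf0, degRevLex_le_iff.1 (hq' j).2⟩⟩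
  · rintro q r ⟨hq, hq'⟩ ⟨hr, hr'⟩
    have key {p : Fin t → MvPolynomial (Fin n) K}
        (hp : ∀ j, p j ≠ 0 → (∀ m ∈ (p j).support, m ∈ S j) ∧ f ≠ 0 ∧
          drle ((degRevLex n).degree (p j * h j)) ((degRevLex n).degree f))
        (j : Fin t) (a : Mon n) (ha : a ∈ (p j).support) : a ∈ S j :=
      (hp j (by rintro h0; simp [h0] at ha)).1 a ha
    refine sub_eq_zero.1 ((degRevLex n).eq_zero_of_sum_mul_eq_zero hne S hdisj (q := q - r)
      (fun j a ha => ?_) ?_)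
    · classical
      rcases Finset.mem_union.1 (support_sub _ _ _ ha) with ha | ha
      exacts [key hq' j a ha, key hr' j a ha]
    · simp [sub_mul, Finset.sum_sub_distrib, ← hq, ← hr]
end
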